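/- Let (𝔫, ⟨·,·⟩) be a 2-step nilpotent metric Lie algebra whose center z(𝔫) is 1-dimensional, and let 2 ≤ k ≤ dim 𝔫. If k is even, then every Killing k-form on (𝔫, ⟨·,·⟩) is zero. If k is odd, then the space of Killing k-forms on (𝔫, ⟨·,·⟩) is a 1-dimensional linear subspace of the space of alternating k-forms (generated by ξ^♭ ∧ A ∧ ... ∧ A, where ξ is a unit vector spanning z(𝔫) and A is the 2-form corresponding to the skew-symmetric endomorphism j(ξ)). -/

import Mathlib

section Defs

variable {g : Type*} [LieRing g] [LieAlgebra ℝ g]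

/-- `B` is a (positive definite) inner product on the real Lie algebra `g`,
given as a bilinear form. -/
structure IsInnerProduct (B : g →ₗ[ℝ] g →ₗ[ℝ] ℝ) : Prop where
  symm : ∀ x y : g, B x y = B y x
  posdef : ∀ x : g, x ≠ 0 → 0 < B x x

/-- The Koszul formula characterizing the Levi-Civita connection of the metric Lie
algebra `(g, B)`: `2⟨∇ₓy, z⟩ = ⟨[x,y], z⟩ − ⟨[y,z], x⟩ + ⟨[z,x], y⟩`. -/
def IsLeviCivita (B : g →ₗ[ℝ] g →ₗ[ℝ] ℝ) (D : g → g → g) : Prop :=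
  ∀ x y z : g, 2 * B (D x y) z = B ⁅x, y⁆ z - B ⁅y, z⁆ x + B ⁅z, x⁆ y

/-- A skew-symmetric endomorphism with respect to `B`. -/
def IsSkewSymmetric (B : g →ₗ[ℝ] g →ₗ[ℝ] ℝ) (T : g →ₗ[ℝ] g) : Prop :=
  ∀ x y : g, B (T x) y = - B x (T y)

/-- The conformal Killing-Yano equation for an endomorphism `T` with associated 1-form `θ`:
`⟨(∇ₓT)y, z⟩ + ⟨(∇_yT)x, z⟩ = 2⟨x,y⟩θ(z) − ⟨y,z⟩θ(x) − ⟨x,z⟩θ(y)`,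
where `(∇ₓT)y = ∇ₓ(Ty) − T(∇ₓy)`. -/
def IsCKYWith (B : g →ₗ[ℝ] g →ₗ[ℝ] ℝ) (D : g → g → g) (T : g →ₗ[ℝ] g)
    (θ : g →ₗ[ℝ] ℝ) : Prop :=
  ∀ x y z : g,
    B (D x (T y) - T (D x y)) z + B (D y (T x) - T (D y x)) z =
      2 * B x y * θ z - B y z * θ x - B x z * θ y

/-- A Killing-Yano tensor is a CKY tensor with `θ = 0`. -/
def IsKY (B : g →ₗ[ℝ] g →ₗ[ℝ] ℝ) (D : g → g → g) (T : g →ₗ[ℝ] g) : Prop :=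
  IsCKYWith B D T 0

/-- A parallel tensor: `(∇ₓT)y = 0` for all `x, y`. -/
def IsParallelT (D : g → g → g) (T : g →ₗ[ℝ] g) : Prop :=
  ∀ x y : g, D x (T y) - T (D x y) = 0

/-- The orthogonal complement of a submodule with respect to the bilinear form `B`. -/
def orthComp (B : g →ₗ[ℝ] g →ₗ[ℝ] ℝ) (p : Submodule ℝ g) : Submodule ℝ g where
  carrier := {x : g | ∀ y ∈ p, B x y = 0}
  add_mem' := by
    intro a b ha hb y hy
    simp only [map_add, LinearMap.add_apply, ha y hy, hb y hy, add_zero]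
  zero_mem' := by
    intro y hy
    simp
  smul_mem' := by
    intro c a ha y hy
    simp only [map_smul, LinearMap.smul_apply, ha y hy, smul_eq_mul, mul_zero]

end Defs

section KillingForms

variable {g : Type*} [LieRing g] [LieAlgebra ℝ g]

/-- Covariant derivative of an alternating `k`-form:
`(∇ₓη)(y₁, …, y_k) = −Σᵢ η(y₁, …, ∇ₓyᵢ, …, y_k)`. -/
def formDeriv {k : ℕ} (D : g → g → g) (η : AlternatingMap ℝ g ℝ (Fin k)) (x : g)
    (v : Fin k → g) : ℝ :=
  -∑ i, η (Function.update v i (D x (v i)))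

/-- The Killing equation for a `k`-form:
`(∇ₓη)(y, y₂, …, y_k) + (∇_yη)(x, y₂, …, y_k) = 0` for all `x, y, y₂, …, y_k`. -/
def IsKillingForm {k : ℕ} [NeZero k] (D : g → g → g)
    (η : AlternatingMap ℝ g ℝ (Fin k)) : Prop :=
  ∀ (x : g) (v : Fin k → g),
    formDeriv D η x v + formDeriv D η (v 0) (Function.update v 0 x) = 0

section DerivationSum

open Finset Function

variable {V ι : Type*} [AddCommGroup V] [Module ℝ V] [Fintype ι] [DecidableEq ι]

/-- The sum `∑ᵢ η(v₁, …, T vᵢ, …, v_k)`. -/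
def derivationSum (η : V [⋀^ι]→ₗ[ℝ] ℝ) (T : V → V) (v : ι → V) : ℝ :=
  ∑ i, η (update v i (T (v i)))

/-- A form satisfies the Killing equation in every slot for the bilinear map `T`. -/
def IsKillingIn (T : V →ₗ[ℝ] V →ₗ[ℝ] V) (η : V [⋀^ι]→ₗ[ℝ] ℝ) : Prop :=
  ∀ (v : ι → V) (j : ι), derivationSum η (T (v j)) v = 0

theorem derivationSum_comp_perm (η : V [⋀^ι]→ₗ[ℝ] ℝ) (T : V → V) (v : ι → V)
    (σ : Equiv.Perm ι) :
    derivationSum η T (v ∘ σ) = Equiv.Perm.sign σ • derivationSum η T v := by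
  unfold derivationSum
  rw [smul_sum, ← Equiv.sum_comp σ (fun i => Equiv.Perm.sign σ • η (update v i (T (v i))))]
  refine sum_congr rfl fun i _ => ?_
  rw [← η.map_perm]
  congr 1
  ext l
  by_cases h : l = i
  · subst h; simp
  · simp [h]

theorem derivationSum_update_add (η : V [⋀^ι]→ₗ[ℝ] ℝ) (T : V →ₗ[ℝ] V) (v : ι → V) (j : ι)
    (a b : V) :
    derivationSum η T (update v j (a + b)) =
      derivationSum η T (update v j a) + derivationSum η T (update v j b) := by
  unfold derivationSum
  rw [← sum_add_distrib]
  refine sum_congr rfl fun i _ => ?_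
  by_cases h : i = j
  · subst h; simp
  · simp only [update_of_ne h]
    rw [update_comm (Ne.symm h), update_comm (Ne.symm h), update_comm (Ne.symm h),
      η.map_update_add]

theorem derivationSum_add (η : V [⋀^ι]→ₗ[ℝ] ℝ) (T : V →ₗ[ℝ] V →ₗ[ℝ] V) (v : ι → V) (a b : V) :
    derivationSum η (T (a + b)) v = derivationSum η (T a) v + derivationSum η (T b) v := by
  simp [derivationSum, ← sum_add_distrib]

theorem IsKillingIn.polarize {T : V →ₗ[ℝ] V →ₗ[ℝ] V} {η : V [⋀^ι]→ₗ[ℝ] ℝ}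
    (h : IsKillingIn T η) (v : ι → V) (j : ι) (x y : V) :
    derivationSum η (T x) (update v j y) + derivationSum η (T y) (update v j x) = 0 := by
  have hx := h (update v j x) j
  have hy := h (update v j y) j
  have hxy := h (update v j (x + y)) j
  simp only [update_self] at hx hy hxy
  rw [derivationSum_add, derivationSum_update_add, derivationSum_update_add] at hxy
  linarith

theorem IsKillingIn.smul {T : V →ₗ[ℝ] V →ₗ[ℝ] V} {η : V [⋀^ι]→ₗ[ℝ] ℝ}
    (h : IsKillingIn T η) (c : ℝ) : IsKillingIn T (c • η) := by
  intro v j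
  have := h v j
  simp only [derivationSum, AlternatingMap.smul_apply, ← smul_sum] at this ⊢
  rw [this, smul_zero]

theorem IsKillingIn.sub {T : V →ₗ[ℝ] V →ₗ[ℝ] V} {η ω : V [⋀^ι]→ₗ[ℝ] ℝ}
    (h : IsKillingIn T η) (h' : IsKillingIn T ω) : IsKillingIn T (η - ω) := by
  intro v j
  have h1 := h v j
  have h2 := h' v j
  simp only [derivationSum, AlternatingMap.sub_apply, sum_sub_distrib] at h1 h2 ⊢
  rw [h1, h2, sub_zero]

theorem IsKillingIn.domDomCongr {κ : Type*} [Fintype κ] [DecidableEq κ]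
    {T : V →ₗ[ℝ] V →ₗ[ℝ] V} {η : V [⋀^ι]→ₗ[ℝ] ℝ}
    (h : IsKillingIn T η) (e : ι ≃ κ) : IsKillingIn T (η.domDomCongr e) := by
  intro v j
  have := h (v ∘ e) (e.symm j)
  simp only [comp_apply, Equiv.apply_symm_apply] at this
  rw [← this]
  unfold derivationSum
  rw [← Equiv.sum_comp e]
  refine sum_congr rfl fun i _ => ?_
  rw [AlternatingMap.domDomCongr_apply]
  congr 1
  ext l
  by_cases h : l = i
  · subst h; simp
  · simp [h]

end DerivationSum

section KillingFormIn

open Finset Function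

variable {g : Type*} [LieRing g] [LieAlgebra ℝ g]

theorem isKillingForm_iff_isKillingIn {k : ℕ} [NeZero k] (T : g →ₗ[ℝ] g →ₗ[ℝ] g)
    (η : AlternatingMap ℝ g ℝ (Fin k)) :
    IsKillingForm (fun x y => T x y) η ↔ IsKillingIn T η := by
  have key : ∀ x v, formDeriv (fun x y => T x y) η x v = -derivationSum η (T x) v :=
    fun x v => rfl
  constructor
  · intro h v j
    have h0 := h ((v ∘ Equiv.swap 0 j) 0) (v ∘ Equiv.swap 0 j)
    rw [update_eq_self, key, derivationSum_comp_perm] at h0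
    simp only [comp_apply, Equiv.swap_apply_left] at h0
    have h1 : Equiv.Perm.sign (Equiv.swap 0 j) • derivationSum η (T (v j)) v = 0 := by linarith
    exact (smul_eq_zero_iff_eq _).1 h1
  · intro h x v
    have := h.polarize v 0 x (v 0)
    rw [update_eq_self] at this
    rw [key, key]
    linarith

end KillingFormIn

section ContactConnection

open Finset Function

variable {V ι : Type*} [AddCommGroup V] [Module ℝ V] [Fintype ι] [DecidableEq ι]

/-- The linear algebra underlying a 2-step nilpotent metric Lie algebra whose centre is spanned
by the unit vector `ξ`: the 1-form `ℓ` dual to `ξ`, the 2-form `A`, and the endomorphism `J`. -/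
structure IsContactData (ℓ : V →ₗ[ℝ] ℝ) (A : V →ₗ[ℝ] V →ₗ[ℝ] ℝ) (J : V →ₗ[ℝ] V) (ξ : V) :
    Prop where
  apply_xi : ℓ ξ = 1
  alt : ∀ x, A x x = 0
  left_xi : ∀ x, A ξ x = 0
  apply_J : ∀ x, ℓ (J x) = 0
  skew : ∀ x y, A (J x) y = -A x (J y)
  radical : ∀ x, (∀ y, A x y = 0) → ∃ c : ℝ, x = c • ξ
  exists_J_eq : ∀ x, ℓ x = 0 → ∃ y, ℓ y = 0 ∧ J y = x

/-- Twice the Levi-Civita connection, in terms of contact data. -/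
def contactConnection (ℓ : V →ₗ[ℝ] ℝ) (A : V →ₗ[ℝ] V →ₗ[ℝ] ℝ) (J : V →ₗ[ℝ] V) (ξ : V) :
    V →ₗ[ℝ] V →ₗ[ℝ] V :=
  LinearMap.mk₂ ℝ (fun x y => A x y • ξ - ℓ x • J y - ℓ y • J x)
    (by intros; simp; module) (by intros; simp; module)
    (by intros; simp; module) (by intros; simp; module)

variable {ℓ : V →ₗ[ℝ] ℝ} {A : V →ₗ[ℝ] V →ₗ[ℝ] ℝ} {J : V →ₗ[ℝ] V} {ξ : V}

theorem contactConnection_apply (x y : V) :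
    contactConnection ℓ A J ξ x y = A x y • ξ - ℓ x • J y - ℓ y • J x := rfl

theorem derivationSum_contactConnection (η : V [⋀^ι]→ₗ[ℝ] ℝ) (x : V) (v : ι → V) :
    derivationSum η (contactConnection ℓ A J ξ x) v =
      ∑ i, A x (v i) * η (update v i ξ) - ℓ x * ∑ i, η (update v i (J (v i)))
        - ∑ i, ℓ (v i) * η (update v i (J x)) := by
  simp [derivationSum, contactConnection_apply, sum_sub_distrib, mul_sum]

namespace IsContactData

theorem swap (h : IsContactData ℓ A J ξ) (x y : V) : A x y = -A y x := by
  have := h.alt (x + y)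
  simp only [map_add, LinearMap.add_apply, h.alt] at this
  linarith

theorem right_xi (h : IsContactData ℓ A J ξ) (x : V) : A x ξ = 0 := by
  rw [h.swap, h.left_xi, neg_zero]

theorem killing_J_self (h : IsContactData ℓ A J ξ) {η : V [⋀^ι]→ₗ[ℝ] ℝ}
    (hη : IsKillingIn (contactConnection ℓ A J ξ) η) {i j : ι} (hij : i ≠ j) (v : ι → V)
    (hv : ∀ l, ℓ (v l) = 0) (x : V) (hx : ℓ x = 0) :
    η (update (update v i x) j (J x)) = 0 := by
  have key := hη (update (update v i x) j ξ) i
  rw [update_of_ne hij, update_self, derivationSum_contactConnection, hx, zero_mul, sub_zero,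
    sum_eq_zero, zero_sub, neg_eq_zero, sum_eq_single j] at key
  · simpa [h.apply_xi] using key
  · intro l _ hl
    by_cases hli : l = i
    · subst hli; simp [hl, hx]
    · simp [hl, hli, hv]
  · simp
  · intro l _
    by_cases hl : l = j
    · subst hl; simp [h.right_xi]
    · rw [η.map_eq_zero_of_eq (i := l) (j := j) _ _ hl, mul_zero]
      simp [Ne.symm hl]

theorem killing_J_comm (h : IsContactData ℓ A J ξ) {η : V [⋀^ι]→ₗ[ℝ] ℝ}
    (hη : IsKillingIn (contactConnection ℓ A J ξ) η) (i j : ι) (v : ι → V)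
    (hv : ∀ l, ℓ (v l) = 0) :
    η (update v i (J (v i))) = η (update v j (J (v j))) := by
  by_cases hij : i = j
  · rw [hij]
  have e1 := h.killing_J_self hη hij v hv (v i) (hv i)
  have e2 := h.killing_J_self hη hij v hv (v j) (hv j)
  have e3 := h.killing_J_self hη hij v hv (v i + v j) (by simp [hv])
  rw [map_add, η.map_update_add, update_comm hij, update_comm hij, η.map_update_add,
    η.map_update_add, update_comm (Ne.symm hij), update_comm (Ne.symm hij),
    update_comm (Ne.symm hij), update_comm (Ne.symm hij), e1, e2, zero_add, add_zero,
    update_eq_self] at e3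
  have e4 := η.map_swap (update v i (J (v i))) hij
  rw [Equiv.comp_swap_eq_update] at e4
  simp only [update_self, update_of_ne (Ne.symm hij)] at e4
  rw [update_comm (Ne.symm hij), update_idem] at e4
  linarith

theorem killing_eq_zero_of_horizontal (h : IsContactData ℓ A J ξ) [Nonempty ι]
    {η : V [⋀^ι]→ₗ[ℝ] ℝ}
    (hη : IsKillingIn (contactConnection ℓ A J ξ) η) (v : ι → V)
    (hv : ∀ l, ℓ (v l) = 0) : η v = 0 := by
  obtain ⟨j⟩ := ‹Nonempty ι›
  obtain ⟨y, hy, hJy⟩ := h.exists_J_eq (v j) (hv j)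
  set u := update v j y with hu
  have hul : ∀ l, ℓ (u l) = 0 := by
    intro l
    by_cases hl : l = j
    · subst hl; simpa [hu]
    · simpa [hu, hl] using hv l
  have huj : u j = y := by simp [hu]
  have goal : η (update u j (J (u j))) = η v := by
    rw [huj, hJy, hu, update_idem, update_eq_self]
  have key := hη.polarize u j ξ (u j)
  rw [update_eq_self, derivationSum_contactConnection, derivationSum_contactConnection] at key
  have s1 : ∑ i, η (update u i (J (u i))) = Fintype.card ι * η v := by
    rw [sum_congr rfl fun i _ => h.killing_J_comm hη i j u hul, goal]
    simp
  have s2 : ∑ i, A (u j) (update u j ξ i) * η (update (update u j ξ) i ξ) = 0 := by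
    refine sum_eq_zero fun l _ => ?_
    by_cases hl : l = j
    · subst hl; simp [h.right_xi]
    · rw [η.map_eq_zero_of_eq (i := l) (j := j) _ _ hl, mul_zero]
      simp [Ne.symm hl]
  have s3 : ∑ i, ℓ (update u j ξ i) * η (update (update u j ξ) i (J (u j))) = η v := by
    rw [sum_eq_single j]
    · simp [h.apply_xi, goal]
    · intro l _ hl
      simp [hl, hul]
    · simp
  rw [s1, s2, s3, hul] at key
  simp only [h.left_xi, h.apply_xi, hul, zero_mul, sum_const_zero] at key
  have : ((Fintype.card ι : ℝ) + 1) * η v = 0 := by linarith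
  rcases mul_eq_zero.1 this with h0 | h0
  · have : (0 : ℝ) ≤ Fintype.card ι := Nat.cast_nonneg _
    linarith
  · exact h0

theorem killing_eq_zero_of_orthogonal (h : IsContactData ℓ A J ξ) {η : V [⋀^ι]→ₗ[ℝ] ℝ}
    (hη : IsKillingIn (contactConnection ℓ A J ξ) η) (v : ι → V) {i j : ι} (hij : i ≠ j)
    (hi : v i = ξ) (hv : ∀ l, l ≠ i → ℓ (v l) = 0) (hA : ∀ l, A (v j) (v l) = 0) :
    η v = 0 := by
  by_cases hrad : ∀ y, A (v j) y = 0
  · obtain ⟨c, hc⟩ := h.radical _ hrad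
    have h0 := hv j (Ne.symm hij)
    rw [hc, map_smul, h.apply_xi, smul_eq_mul, mul_one] at h0
    exact η.map_coord_zero j (by rw [hc, h0, zero_smul])
  push Not at hrad
  obtain ⟨y, hy⟩ := hrad
  have key := hη (update v i (y - ℓ y • ξ)) j
  rw [update_of_ne (Ne.symm hij), derivationSum_contactConnection, hv j (Ne.symm hij),
    sum_eq_single i] at key
  · have hs : ∑ l, ℓ (update v i (y - ℓ y • ξ) l) *
        η (update (update v i (y - ℓ y • ξ)) l (J (v j))) = 0 := by
      refine sum_eq_zero fun l _ => ?_
      by_cases hl : l = i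
      · subst hl; simp [h.apply_xi]
      · simp [hl, hv]
    rw [hs] at key
    simp only [update_self, update_idem, map_sub, map_smul, h.right_xi] at key
    rw [← hi, update_eq_self] at key
    simpa [hy] using key
  · intro l _ hl
    simp [hl, hA]
  · simp

end IsContactData

end ContactConnection

section Darboux

open Finset Function

variable {V : Type*} [AddCommGroup V] [Module ℝ V]

/-- A symplectic family `e, f` for an alternating bilinear form. -/
structure IsSymplecticFamily (A : V →ₗ[ℝ] V →ₗ[ℝ] ℝ) {m : ℕ} (e f : Fin m → V) : Prop where
  left : ∀ i j, A (e i) (e j) = 0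
  right : ∀ i j, A (f i) (f j) = 0
  pair : ∀ i j, A (e i) (f j) = if i = j then 1 else 0

/-- A spanning family consisting of `ξ` and a horizontal symplectic family indexed by pairs. -/
structure IsDarbouxFamily (ℓ : V →ₗ[ℝ] ℝ) (A : V →ₗ[ℝ] V →ₗ[ℝ] ℝ) (ξ : V) {κ : Type*}
    (b : Option (κ × Bool) → V) : Prop where
  none_eq : b none = ξ
  horizontal : ∀ q, ℓ (b (some q)) = 0
  orth : ∀ a s t, t ≠ some (a, !s) → A (b (some (a, s))) (b t) = 0
  pair : ∀ a, A (b (some (a, false))) (b (some (a, true))) = 1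
  span_eq_top : Submodule.span ℝ (Set.range b) = ⊤

variable {ℓ : V →ₗ[ℝ] ℝ} {A : V →ₗ[ℝ] V →ₗ[ℝ] ℝ} {J : V →ₗ[ℝ] V} {ξ : V}

theorem IsSymplecticFamily.le_finrank [FiniteDimensional ℝ V] {m : ℕ} {e f : Fin m → V}
    (h : IsSymplecticFamily A e f) : m ≤ Module.finrank ℝ V := by
  have hli : LinearIndependent ℝ e := by
    rw [Fintype.linearIndependent_iff]
    intro c hc i
    have := congrArg (fun x => A x (f i)) hc
    simpa [h.pair] using this
  simpa using hli.fintype_card_le_finrank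

theorem IsContactData.exists_symplecticFamily [FiniteDimensional ℝ V]
    (h : IsContactData ℓ A J ξ) :
    ∃ (m : ℕ) (e f : Fin m → V), IsSymplecticFamily A e f ∧
      ∀ x, ∃ c : ℝ, x = c • ξ + ∑ i, (A x (f i) • e i - A x (e i) • f i) := by
  classical
  let P : ℕ → Prop := fun m => ∃ e f : Fin m → V, IsSymplecticFamily A e f
  have hP0 : P 0 := ⟨finZeroElim, finZeroElim, ⟨finZeroElim, finZeroElim, finZeroElim⟩⟩
  have hPle : ∀ m, P m → m ≤ Module.finrank ℝ V := fun m ⟨e, f, hef⟩ => hef.le_finrank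
  set m := Nat.findGreatest P (Module.finrank ℝ V) with hm
  obtain ⟨e, f, hef⟩ : P m := Nat.findGreatest_spec (Nat.zero_le _) hP0
  have hmax : ¬P (m + 1) := fun hP =>
    absurd (Nat.le_findGreatest (hPle _ hP) hP) (by omega)
  have hfe : ∀ i j, A (f i) (e j) = if i = j then -1 else 0 := by
    intro i j
    rw [h.swap, hef.pair]
    by_cases hij : i = j
    · simp [hij]
    · simp [hij, Ne.symm hij]
  let proj : V → V := fun x => x - ∑ i, (A x (f i) • e i - A x (e i) • f i)
  have hproj_e : ∀ x j, A (proj x) (e j) = 0 := by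
    intro x j
    simp [proj, hef.left, hfe]
  have hproj_f : ∀ x j, A (proj x) (f j) = 0 := by
    intro x j
    simp [proj, hef.right, hef.pair]
  have hproj_proj : ∀ x y, A (proj x) (proj y) = A (proj x) y := by
    intro x y
    conv_lhs => rw [show proj y = y - ∑ i, (A y (f i) • e i - A y (e i) • f i) from rfl]
    simp [hproj_e, hproj_f]
  have hrad : ∀ x, ∃ c : ℝ, proj x = c • ξ := by
    intro x
    refine h.radical _ fun y => ?_
    by_contra hy
    refine hmax ⟨Fin.cons (proj x) e, Fin.cons ((A (proj x) y)⁻¹ • proj y) f, ?_, ?_, ?_⟩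
    · intro i j
      refine Fin.cases ?_ (fun i => ?_) i <;> refine Fin.cases ?_ (fun j => ?_) j
      · simp [h.alt]
      · simp [hproj_e]
      · rw [h.swap]; simp [hproj_e]
      · simp [hef.left]
    · intro i j
      refine Fin.cases ?_ (fun i => ?_) i <;> refine Fin.cases ?_ (fun j => ?_) j
      · simp [h.alt]
      · simp [hproj_f]
      · rw [h.swap]; simp [hproj_f]
      · simp [hef.right]
    · intro i j
      refine Fin.cases ?_ (fun i => ?_) i <;> refine Fin.cases ?_ (fun j => ?_) j
      · simp [hproj_proj, hy]
      · simp [hproj_f, (Fin.succ_ne_zero j).symm]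
      · rw [h.swap]; simp [hproj_e, Fin.succ_ne_zero]
      · simp [hef.pair]
  refine ⟨m, e, f, hef, fun x => ?_⟩
  obtain ⟨c, hc⟩ := hrad x
  exact ⟨c, by rw [← hc]; simp [proj]⟩

theorem IsContactData.exists_darbouxFamily [FiniteDimensional ℝ V]
    (h : IsContactData ℓ A J ξ) :
    ∃ (m : ℕ) (b : Option (Fin m × Bool) → V), IsDarbouxFamily ℓ A ξ b := by
  obtain ⟨m, e, f, hef, hspan⟩ := h.exists_symplecticFamily
  have hfe : ∀ i j, i ≠ j → A (f i) (e j) = 0 := by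
    intro i j hij
    rw [h.swap, hef.pair, if_neg (Ne.symm hij), neg_zero]
  let b : Option (Fin m × Bool) → V := fun t => t.elim ξ fun q =>
    if q.2 then f q.1 - ℓ (f q.1) • ξ else e q.1 - ℓ (e q.1) • ξ
  have hb : ∀ t, b t ∈ Submodule.span ℝ (Set.range b) :=
    fun t => Submodule.subset_span ⟨t, rfl⟩
  have hξ : ξ ∈ Submodule.span ℝ (Set.range b) := hb none
  refine ⟨m, b, rfl, ?_, ?_, ?_, ?_⟩
  · rintro ⟨a, _ | _⟩ <;> simp [b, h.apply_xi]
  · rintro a s (_ | ⟨c, t⟩) ht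
    · simp [b, h.right_xi]
    · cases s <;> cases t <;> simp [b, h.left_xi, h.right_xi, hef.left, hef.right]
      · rw [hef.pair, if_neg]
        rintro rfl
        simp at ht
      · refine hfe _ _ ?_
        rintro rfl
        simp at ht
  · intro a
    simp [b, h.left_xi, h.right_xi, hef.pair]
  · rw [eq_top_iff]
    intro x _
    have he : ∀ i, e i ∈ Submodule.span ℝ (Set.range b) := by
      intro i
      have := add_mem (hb (some (i, false))) (Submodule.smul_mem _ (ℓ (e i)) hξ)
      simpa [b] using this
    have hf : ∀ i, f i ∈ Submodule.span ℝ (Set.range b) := by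
      intro i
      have := add_mem (hb (some (i, true))) (Submodule.smul_mem _ (ℓ (f i)) hξ)
      simpa [b] using this
    obtain ⟨c, hc⟩ := hspan x
    rw [hc]
    exact add_mem (Submodule.smul_mem _ _ hξ) (sum_mem fun i _ =>
      sub_mem (Submodule.smul_mem _ _ (he i)) (Submodule.smul_mem _ _ (hf i)))

end Darboux

section Uniqueness

open Finset Function

variable {V ι κ : Type*} [AddCommGroup V] [Module ℝ V] [Fintype ι] [DecidableEq ι]
  {ℓ : V →ₗ[ℝ] ℝ} {A : V →ₗ[ℝ] V →ₗ[ℝ] ℝ} {J : V →ₗ[ℝ] V} {ξ : V}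

/-- The form `η` vanishes on all tuples from `b` with pair indices in `I`. -/
def VanishesOnPairs (η : V [⋀^ι]→ₗ[ℝ] ℝ) (b : Option (κ × Bool) → V) (I : Finset κ) : Prop :=
  ∀ t : ι → Option (κ × Bool), (∀ l q, t l = some q → q.1 ∈ I) → η (b ∘ t) = 0

theorem VanishesOnPairs.of_injective {η : V [⋀^ι]→ₗ[ℝ] ℝ} {b : Option (κ × Bool) → V}
    {I : Finset κ} (u : ι → Option (κ × Bool))
    (hI : ∀ t, (∀ q, t = some q → q.1 ∈ I) → t ∈ Set.range u) (hu : η (b ∘ u) = 0) :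
    VanishesOnPairs η b I := by
  intro t ht
  by_cases hinj : Injective t
  · choose σ hσ using fun l => hI (t l) (ht l)
    have hσinj : Injective σ := fun x y hxy => hinj (by rw [← hσ x, ← hσ y, hxy])
    have : b ∘ t = (b ∘ u) ∘ Equiv.ofBijective σ (Finite.injective_iff_bijective.1 hσinj) := by
      ext l
      simp [hσ]
    rw [this, η.map_perm, hu, smul_zero]
  · exact η.map_eq_zero_of_not_injective _ fun hi => hinj hi.of_comp

namespace IsDarbouxFamily

variable {b : Option (κ × Bool) → V} {η : V [⋀^ι]→ₗ[ℝ] ℝ}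

theorem killing_eq_zero_of_ne_none (hb : IsDarbouxFamily ℓ A ξ b) (h : IsContactData ℓ A J ξ)
    [Nonempty ι] (hη : IsKillingIn (contactConnection ℓ A J ξ) η)
    (t : ι → Option (κ × Bool)) (ht : ∀ l, t l ≠ none) : η (b ∘ t) = 0 := by
  refine h.killing_eq_zero_of_horizontal hη _ fun l => ?_
  obtain ⟨q, hq⟩ := Option.ne_none_iff_exists'.1 (ht l)
  simp [hq, hb.horizontal]

theorem killing_eq_zero_of_unpaired (hb : IsDarbouxFamily ℓ A ξ b) (h : IsContactData ℓ A J ξ)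
    (hη : IsKillingIn (contactConnection ℓ A J ξ) η)
    (t : ι → Option (κ × Bool)) (j : ι) {a : κ} {s : Bool} (hj : t j = some (a, s))
    (ht : ∀ l, t l ≠ some (a, !s)) : η (b ∘ t) = 0 := by
  by_cases hinj : Injective t
  swap
  · exact η.map_eq_zero_of_not_injective _ fun hi => hinj hi.of_comp
  by_cases hnone : ∃ i, t i = none
  swap
  · have : Nonempty ι := ⟨j⟩
    exact hb.killing_eq_zero_of_ne_none h hη t (by simpa using hnone)
  obtain ⟨i, hi⟩ := hnone
  refine h.killing_eq_zero_of_orthogonal hη _ (i := i) (j := j) ?_ (by simp [hi, hb.none_eq])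
    ?_ ?_
  · rintro rfl
    simp [hi] at hj
  · intro l hl
    obtain ⟨q, hq⟩ := Option.ne_none_iff_exists'.1
      (show t l ≠ none from fun h0 => hl (hinj (h0.trans hi.symm)))
    simp [hq, hb.horizontal]
  · intro l
    simpa [hj] using hb.orth a s (t l) (ht l)

theorem sign_mul_pair (hb : IsDarbouxFamily ℓ A ξ b) (h : IsContactData ℓ A J ξ) (a : κ)
    (s : Bool) : A (b (some (a, s))) (b (some (a, !s))) = if s then -1 else 1 := by
  cases s
  · simpa using hb.pair a
  · rw [h.swap]
    simpa using hb.pair a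

theorem vanishesOnPairs_exchange [DecidableEq κ] (hb : IsDarbouxFamily ℓ A ξ b)
    (h : IsContactData ℓ A J ξ) (hη : IsKillingIn (contactConnection ℓ A J ξ) η)
    {I : Finset κ} {a c : κ} (ha : a ∈ I) (hc : c ∉ I) (hI : VanishesOnPairs η b I) :
    VanishesOnPairs η b (insert c (I.erase a)) := by
  intro t ht
  have hac : a ≠ c := fun h => hc (h ▸ ha)
  by_cases hinj : Injective t
  swap
  · exact η.map_eq_zero_of_not_injective _ fun hi => hinj hi.of_comp
  by_cases hcs : ∃ j s, t j = some (c, s)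
  swap
  · refine hI t fun l q hq => ?_
    have := ht l q hq
    rw [mem_insert, mem_erase] at this
    rcases this with h0 | h0
    · exact absurd ⟨l, q.2, by rw [hq, ← h0]⟩ hcs
    · exact h0.2
  obtain ⟨j, s, hj⟩ := hcs
  by_cases hcs' : ∃ j', t j' = some (c, !s)
  swap
  · exact hb.killing_eq_zero_of_unpaired h hη t j hj (by simpa using hcs')
  obtain ⟨j', hj'⟩ := hcs'
  by_cases hnone : ∃ i, t i = none
  swap
  · have : Nonempty ι := ⟨j⟩
    exact hb.killing_eq_zero_of_ne_none h hη t (by simpa using hnone)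
  obtain ⟨i, hi⟩ := hnone
  have hjj' : j ≠ j' := by
    rintro rfl
    simp [hj] at hj'
  have hij : i ≠ j := by
    rintro rfl
    simp [hj] at hi
  have hij' : i ≠ j' := by
    rintro rfl
    simp [hj'] at hi
  have hrest : ∀ l, l ≠ j → l ≠ j' → ∀ q, t l = some q → q.1 ∈ I ∧ q.1 ≠ a ∧ q.1 ≠ c := by
    intro l hlj hlj' q hq
    have hqc : q.1 ≠ c := by
      intro h0
      by_cases hs : q.2 = s
      · exact hlj (hinj (by rw [hq, hj, ← h0, ← hs]))
      · refine hlj' (hinj ?_)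
        rw [hq, hj', ← h0, ← Bool.eq_not.2 hs]
    have := ht l q hq
    rw [mem_insert, mem_erase] at this
    rcases this with h0 | h0
    · exact absurd h0 hqc
    · exact ⟨h0.2, h0.1, hqc⟩
  have horth : ∀ l, l ≠ j → l ≠ j' → ∀ r, t l ≠ some (a, r) ∧ t l ≠ some (c, r) := by
    intro l hlj hlj' r
    exact ⟨fun h0 => (hrest l hlj hlj' _ h0).2.1 rfl, fun h0 => (hrest l hlj hlj' _ h0).2.2 rfl⟩
  have hdiag : η (update (update (b ∘ t) j (b (some (c, s)) + b (some (a, s)))) j'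
      (b (some (c, !s)) - b (some (a, !s)))) = 0 := by
    refine h.killing_eq_zero_of_orthogonal hη _ hij (by simp [hij, hij', hi, hb.none_eq]) ?_ ?_
    · intro l hl
      by_cases hlj' : l = j'
      · subst hlj'; simp [hb.horizontal]
      by_cases hlj : l = j
      · subst hlj; simp [hb.horizontal, hlj']
      obtain ⟨q, hq⟩ := Option.ne_none_iff_exists'.1
        (show t l ≠ none from fun h0 => hl (hinj (h0.trans hi.symm)))
      simp [hlj, hlj', hq, hb.horizontal]
    · intro l
      by_cases hlj' : l = j'
      · subst hlj'
        simp only [update_of_ne hjj', update_self, map_add, map_sub, LinearMap.add_apply,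
          hb.sign_mul_pair h]
        rw [hb.orth c s _ (by simp [hac]), hb.orth a s _ (by simp [hac.symm])]
        ring
      by_cases hlj : l = j
      · subst hlj
        simp only [update_of_ne hlj', update_self]
        exact h.alt _
      simp only [update_of_ne hjj', update_self, update_of_ne hlj', update_of_ne hlj, map_add,
        LinearMap.add_apply, comp_apply]
      rw [hb.orth c s _ (horth l hlj hlj' _).2, hb.orth a s _ (horth l hlj hlj' _).1, add_zero]
  have hcross₁ : η (b ∘ update (update t j (some (c, s))) j' (some (a, !s))) = 0 := by
    refine hb.killing_eq_zero_of_unpaired h hη _ j (a := c) (s := s) (by simp [hjj']) fun l => ?_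
    by_cases hlj' : l = j'
    · subst hlj'; simp [hac]
    by_cases hlj : l = j
    · subst hlj; simp [hlj']
    simpa [hlj, hlj'] using (horth l hlj hlj' _).2
  have hcross₂ : η (b ∘ update (update t j (some (a, s))) j' (some (c, !s))) = 0 := by
    refine hb.killing_eq_zero_of_unpaired h hη _ j (a := a) (s := s) (by simp [hjj']) fun l => ?_
    by_cases hlj' : l = j'
    · subst hlj'; simp [hac.symm]
    by_cases hlj : l = j
    · subst hlj; simp [hlj']
    simpa [hlj, hlj'] using (horth l hlj hlj' _).1
  have hold : η (b ∘ update (update t j (some (a, s))) j' (some (a, !s))) = 0 := by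
    refine hI _ fun l q hq => ?_
    by_cases hlj' : l = j'
    · subst hlj'
      simp only [update_self, Option.some.injEq] at hq
      rw [← hq]; exact ha
    by_cases hlj : l = j
    · subst hlj
      simp only [update_of_ne hlj', update_self, Option.some.injEq] at hq
      rw [← hq]; exact ha
    rw [update_of_ne hlj', update_of_ne hlj] at hq
    exact (hrest l hlj hlj' q hq).1
  have hself : update (update t j (some (c, s))) j' (some (c, !s)) = t := by
    rw [← hj, update_eq_self, ← hj', update_eq_self]
  have hnew : η (b ∘ update (update t j (some (c, s))) j' (some (c, !s))) = 0 := by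
    simp only [comp_update] at hcross₁ hcross₂ hold ⊢
    rw [η.map_update_sub, update_comm hjj', update_comm hjj', η.map_update_add,
      η.map_update_add, update_comm hjj'.symm, update_comm hjj'.symm, update_comm hjj'.symm,
      update_comm hjj'.symm] at hdiag
    linarith
  rwa [hself] at hnew

theorem vanishesOnPairs_of_card_eq [DecidableEq κ] (hb : IsDarbouxFamily ℓ A ξ b)
    (h : IsContactData ℓ A J ξ) (hη : IsKillingIn (contactConnection ℓ A J ξ) η)
    {I I' : Finset κ} (hcard : #I = #I') (hI : VanishesOnPairs η b I) :
    VanishesOnPairs η b I' := by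
  induction hn : #(I \ I') generalizing I with
  | zero =>
    rw [card_eq_zero, sdiff_eq_empty_iff_subset] at hn
    rwa [← eq_of_subset_of_card_le hn hcard.ge]
  | succ n ih =>
    have hn' : #(I' \ I) = n + 1 := by rw [← hn, card_sdiff_comm hcard.symm]
    obtain ⟨a, ha⟩ := card_pos.1 (by omega : 0 < #(I \ I'))
    obtain ⟨c, hc⟩ := card_pos.1 (by omega : 0 < #(I' \ I))
    rw [mem_sdiff] at ha hc
    refine ih (I := insert c (I.erase a)) ?_
      (hb.vanishesOnPairs_exchange h hη ha.1 hc.2 hI) ?_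
    · rw [card_insert_of_notMem (by simp [hc.2]), card_erase_of_mem ha.1, ← hcard]
      have := card_pos.2 ⟨a, ha.1⟩
      omega
    · rw [insert_sdiff_of_mem _ hc.1, erase_sdiff_comm, card_erase_of_mem (by simp [ha]), hn]
      rfl

theorem killing_eq_zero_or_pairs [Fintype κ] [DecidableEq κ] [Nonempty ι]
    (hb : IsDarbouxFamily ℓ A ξ b)
    (h : IsContactData ℓ A J ξ) (hη : IsKillingIn (contactConnection ℓ A J ξ) η)
    (t : ι → Option (κ × Bool)) :
    η (b ∘ t) = 0 ∨
      ∃ I : Finset κ, Fintype.card ι = 2 * #I + 1 ∧ ∀ l q, t l = some q → q.1 ∈ I := by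
  by_contra hcon
  push Not at hcon
  obtain ⟨hne, hcon⟩ := hcon
  have hinj : Injective t := by
    by_contra hinj
    exact hne (η.map_eq_zero_of_not_injective _ fun hi => hinj hi.of_comp)
  have hnone : ∃ i, t i = none := by
    by_contra hnone
    exact hne (hb.killing_eq_zero_of_ne_none h hη t (by simpa using hnone))
  have hflip : ∀ j a s, t j = some (a, s) → ∃ l, t l = some (a, !s) := by
    intro j a s hj
    by_contra hl
    exact hne (hb.killing_eq_zero_of_unpaired h hη t j hj (by simpa using hl))
  let I : Finset κ := univ.filter fun a => ∃ l, t l = some (a, false)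
  have hmem : ∀ l q, t l = some q → q.1 ∈ I := by
    rintro l ⟨a, _ | _⟩ hq
    · simpa [I] using ⟨l, hq⟩
    · simpa [I] using hflip l a true hq
  obtain ⟨l, q, hq, hqI⟩ := hcon I (by
    have himage : univ.image t = insertNone (I ×ˢ (univ : Finset Bool)) := by
      ext o
      rw [mem_image]
      rcases o with _ | ⟨a, s⟩
      · simpa using hnone
      · simp only [mem_univ, true_and, some_mem_insertNone, mem_product, and_true]
        constructor
        · rintro ⟨l, hl⟩
          exact hmem l _ hl
        · intro ha
          obtain ⟨l, hl⟩ : ∃ l, t l = some (a, false) := by simpa [I] using ha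
          cases s
          · exact ⟨l, hl⟩
          · exact hflip l a false hl
    have := congrArg card himage
    rw [card_image_of_injective _ hinj, card_insertNone, card_product, card_univ] at this
    simp only [card_univ, Fintype.card_bool] at this
    omega)
  exact hqI (hmem l q hq)

omit [DecidableEq ι] in
theorem ext_zero (hb : IsDarbouxFamily ℓ A ξ b) (h0 : ∀ t, η (b ∘ t) = 0) : η = 0 := by
  refine AlternatingMap.coe_multilinearMap_injective
    (MultilinearMap.ext_of_span_eq_top (g := fun _ => b) (fun _ => hb.span_eq_top) fun t => ?_)
  exact h0 t

theorem killing_eq_zero_of_even_card [Fintype κ] [Nonempty ι] (hb : IsDarbouxFamily ℓ A ξ b)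
    (h : IsContactData ℓ A J ξ) (hη : IsKillingIn (contactConnection ℓ A J ξ) η)
    (hcard : Even (Fintype.card ι)) : η = 0 := by
  classical
  refine hb.ext_zero fun t => ?_
  rcases hb.killing_eq_zero_or_pairs h hη t with h0 | ⟨I, hI, -⟩
  · exact h0
  · rw [hI] at hcard
    simp [parity_simps] at hcard

theorem killing_eq_zero_of_vanishesOnPairs [Fintype κ] [Nonempty ι]
    (hb : IsDarbouxFamily ℓ A ξ b)
    (h : IsContactData ℓ A J ξ) (hη : IsKillingIn (contactConnection ℓ A J ξ) η)
    {I : Finset κ} (hcard : Fintype.card ι = 2 * #I + 1) (hI : VanishesOnPairs η b I) :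
    η = 0 := by
  classical
  refine hb.ext_zero fun t => ?_
  rcases hb.killing_eq_zero_or_pairs h hη t with h0 | ⟨I', hI', ht⟩
  · exact h0
  · exact hb.vanishesOnPairs_of_card_eq h hη (by omega) hI t ht

end IsDarbouxFamily

end Uniqueness

section Existence

open Finset Function

/-- A sum over permutations weighted by signs vanishes if the summand is invariant under a
transposition. -/
theorem sum_sign_mul_eq_zero {K : Type*} [Fintype K] [DecidableEq K] {i j : K} (hij : i ≠ j)
    (Φ : Equiv.Perm K → ℝ) (hΦ : ∀ σ, Φ (σ * Equiv.swap i j) = Φ σ) :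
    ∑ σ : Equiv.Perm K, ((Equiv.Perm.sign σ : ℤ) : ℝ) * Φ σ = 0 := by
  have h1 := Equiv.sum_comp (Equiv.mulRight (Equiv.swap i j))
    fun σ : Equiv.Perm K => ((Equiv.Perm.sign σ : ℤ) : ℝ) * Φ σ
  simp only [Equiv.coe_mulRight, hΦ, Equiv.Perm.sign_mul, Equiv.Perm.sign_swap hij] at h1
  simp only [mul_neg, mul_one, Units.val_neg, Int.cast_neg, neg_mul, sum_neg_distrib] at h1
  linarith

variable {V κ : Type*} [AddCommGroup V] [Module ℝ V] [Fintype κ] [DecidableEq κ]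
  {ℓ : V →ₗ[ℝ] ℝ} {A : V →ₗ[ℝ] V →ₗ[ℝ] ℝ} {J : V →ₗ[ℝ] V} {ξ : V}

/-- The factors of `∏ A(v_{a,0}, v_{a,1})` other than the one indexed by `a`. -/
def pairProdErase (A : V →ₗ[ℝ] V →ₗ[ℝ] ℝ) (a : κ) (v : Option (κ × Bool) → V) : ℝ :=
  ∏ c ∈ univ.erase a, A (v (some (c, false))) (v (some (c, true)))

/-- The function `v ↦ ℓ(v_none) ∏ A(v_{a,0}, v_{a,1})`. -/
def contactProd (ℓ : V →ₗ[ℝ] ℝ) (A : V →ₗ[ℝ] V →ₗ[ℝ] ℝ) (v : Option (κ × Bool) → V) : ℝ :=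
  ℓ (v none) * ∏ a, A (v (some (a, false))) (v (some (a, true)))

theorem pairProdErase_congr {a : κ} {v w : Option (κ × Bool) → V}
    (h : ∀ c s, c ≠ a → v (some (c, s)) = w (some (c, s))) :
    pairProdErase A a v = pairProdErase A a w :=
  prod_congr rfl fun c hc => by rw [h c _ (ne_of_mem_erase hc), h c _ (ne_of_mem_erase hc)]

theorem pairProd_eq (a : κ) (v : Option (κ × Bool) → V) :
    ∏ c, A (v (some (c, false))) (v (some (c, true))) =
      A (v (some (a, false))) (v (some (a, true))) * pairProdErase A a v :=
  (mul_prod_erase univ _ (mem_univ a)).symm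

omit [DecidableEq κ] in
theorem contactProd_update_none [DecidableEq (Option (κ × Bool))]
    (v : Option (κ × Bool) → V) (y : V) :
    contactProd ℓ A (update v none y) =
      ℓ y * ∏ a, A (v (some (a, false))) (v (some (a, true))) := by
  simp [contactProd]

theorem contactProd_update_false [DecidableEq (Option (κ × Bool))]
    (v : Option (κ × Bool) → V) (a : κ) (y : V) :
    contactProd ℓ A (update v (some (a, false)) y) =
      ℓ (v none) * (A y (v (some (a, true))) * pairProdErase A a v) := by
  rw [contactProd, pairProd_eq a, pairProdErase_congr (w := v)]
  · simp
  · intro c s hc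
    simp [hc]

theorem contactProd_update_true [DecidableEq (Option (κ × Bool))]
    (v : Option (κ × Bool) → V) (a : κ) (y : V) :
    contactProd ℓ A (update v (some (a, true)) y) =
      ℓ (v none) * (A (v (some (a, false))) y * pairProdErase A a v) := by
  rw [contactProd, pairProd_eq a, pairProdErase_congr (w := v)]
  · simp
  · intro c s hc
    simp [hc]

/-- `contactProd` as a multilinear map. -/
def contactMultilinear (ℓ : V →ₗ[ℝ] ℝ) (A : V →ₗ[ℝ] V →ₗ[ℝ] ℝ) :
    MultilinearMap ℝ (fun _ : Option (κ × Bool) => V) ℝ where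
  toFun := contactProd ℓ A
  map_update_add' := by
    intro inst v i x y
    rcases i with _ | ⟨a, _ | _⟩
    · simp only [contactProd_update_none, map_add]; ring
    · simp only [contactProd_update_false, map_add, LinearMap.add_apply]; ring
    · simp only [contactProd_update_true, map_add]; ring
  map_update_smul' := by
    intro inst v i c x
    rcases i with _ | ⟨a, _ | _⟩
    · simp only [contactProd_update_none, map_smul, smul_eq_mul]; ring
    · simp only [contactProd_update_false, map_smul, LinearMap.smul_apply, smul_eq_mul]; ring
    · simp only [contactProd_update_true, map_smul, smul_eq_mul]; ring

/-- The form `ξ^♭ ∧ A ∧ ⋯ ∧ A`, up to a positive factor. -/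
def contactForm (κ : Type*) [Fintype κ] [DecidableEq κ] (ℓ : V →ₗ[ℝ] ℝ)
    (A : V →ₗ[ℝ] V →ₗ[ℝ] ℝ) : V [⋀^(Option (κ × Bool))]→ₗ[ℝ] ℝ :=
  MultilinearMap.alternatization (contactMultilinear ℓ A)

theorem contactForm_apply (v : Option (κ × Bool) → V) :
    contactForm κ ℓ A v = ∑ σ : Equiv.Perm (Option (κ × Bool)),
      ((Equiv.Perm.sign σ : ℤ) : ℝ) * contactProd ℓ A (v ∘ σ) := by
  rw [contactForm, MultilinearMap.alternatization_apply]
  refine sum_congr rfl fun σ _ => ?_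
  rw [Units.smul_def, zsmul_eq_mul]
  rfl

theorem sum_mul_contactForm_update (c : V → ℝ) (T : V → V) (v : Option (κ × Bool) → V) :
    ∑ i, c (v i) * contactForm κ ℓ A (update v i (T (v i))) =
      ∑ σ : Equiv.Perm (Option (κ × Bool)), ((Equiv.Perm.sign σ : ℤ) : ℝ) *
        ∑ i, c (v (σ i)) * contactProd ℓ A (update (v ∘ σ) i (T (v (σ i)))) := by
  simp only [contactForm_apply, mul_sum]
  rw [sum_comm]
  refine sum_congr rfl fun σ _ => ?_
  rw [← Equiv.sum_comp σ]
  refine sum_congr rfl fun i _ => ?_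
  have : update v (σ i) (T (v (σ i))) ∘ σ = update (v ∘ σ) i (T (v (σ i))) :=
    update_comp_eq_of_injective _ σ.injective _ _
  rw [this]
  ring

namespace IsContactData

theorem sum_contactForm_J (h : IsContactData ℓ A J ξ) (v : Option (κ × Bool) → V) :
    ∑ i, contactForm κ ℓ A (update v i (J (v i))) = 0 := by
  have := sum_mul_contactForm_update (ℓ := ℓ) (A := A) (fun _ => 1) J v
  simp only [one_mul] at this
  rw [this]
  refine sum_eq_zero fun σ _ => ?_
  rw [Fintype.sum_option, contactProd_update_none, h.apply_J, zero_mul, zero_add,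
    Fintype.sum_prod_type, sum_eq_zero, mul_zero]
  intro a _
  rw [Fintype.sum_bool, contactProd_update_true, contactProd_update_false, h.skew]
  simp only [comp_apply]
  ring

theorem sum_mul_contactForm_horizontal (v : Option (κ × Bool) → V) {y : V} (hy : ℓ y = 0) :
    ∑ i, ℓ (v i) * contactForm κ ℓ A (update v i y) = 0 := by
  rw [sum_mul_contactForm_update ℓ (fun _ => y)]
  simp only [mul_sum]
  rw [sum_comm]
  refine sum_eq_zero fun i _ => ?_
  rcases i with _ | ⟨a, s⟩
  · simp [contactProd_update_none, hy]
  refine sum_sign_mul_eq_zero (i := none) (j := some (a, s)) (by simp) _ fun σ => ?_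
  have hR : pairProdErase A a (v ∘ (σ * Equiv.swap none (some (a, s)))) =
      pairProdErase A a (v ∘ σ) := by
    refine pairProdErase_congr fun c t hc => ?_
    simp only [comp_apply, Equiv.Perm.mul_apply]
    rw [Equiv.swap_apply_of_ne_of_ne (by simp) (by simp [hc])]
  cases s
  · rw [contactProd_update_false, contactProd_update_false, hR]
    simp only [comp_apply, Equiv.Perm.mul_apply, Equiv.swap_apply_left, Equiv.swap_apply_right]
    rw [Equiv.swap_apply_of_ne_of_ne (by simp) (by simp)]
    ring
  · rw [contactProd_update_true, contactProd_update_true, hR]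
    simp only [comp_apply, Equiv.Perm.mul_apply, Equiv.swap_apply_left, Equiv.swap_apply_right]
    rw [Equiv.swap_apply_of_ne_of_ne (by simp) (by simp)]
    ring

theorem sum_mul_contactForm_xi (h : IsContactData ℓ A J ξ) (v : Option (κ × Bool) → V)
    (j : Option (κ × Bool)) :
    ∑ i, A (v j) (v i) * contactForm κ ℓ A (update v i ξ) = 0 := by
  rw [sum_mul_contactForm_update (A (v j)) (fun _ => ξ)]
  let G : Equiv.Perm (Option (κ × Bool)) → ℝ := fun σ => A (v j) (v (σ none)) *
    ∏ a, A ((v ∘ σ) (some (a, false))) ((v ∘ σ) (some (a, true)))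
  have hG : ∀ σ : Equiv.Perm (Option (κ × Bool)),
      ∑ i, A (v j) (v (σ i)) * contactProd ℓ A (update (v ∘ σ) i ξ) =
        ∑ l, if σ l = j then G σ else 0 := by
    intro σ
    rw [Fintype.sum_option, contactProd_update_none, h.apply_xi, one_mul,
      Fintype.sum_prod_type, sum_eq_zero, add_zero, sum_eq_single (σ.symm j)]
    · simp [G]
    · intro l _ hl
      rw [if_neg]
      rintro rfl
      simp at hl
    · simp
    · intro a _
      rw [Fintype.sum_bool, contactProd_update_true, contactProd_update_false, h.left_xi,
        h.right_xi]
      ring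
  simp only [hG, mul_sum]
  rw [sum_comm]
  refine sum_eq_zero fun l _ => ?_
  rcases l with _ | ⟨a, s⟩
  · refine sum_eq_zero fun σ _ => ?_
    split_ifs with hσ
    · simp [G, hσ, h.alt]
    · simp
  refine sum_sign_mul_eq_zero (i := none) (j := some (a, !s)) (by simp) _ fun σ => ?_
  have hfix : (σ * Equiv.swap none (some (a, !s))) (some (a, s)) = σ (some (a, s)) := by
    rw [Equiv.Perm.mul_apply, Equiv.swap_apply_of_ne_of_ne (by simp) (by simp)]
  have hR : pairProdErase A a (v ∘ (σ * Equiv.swap none (some (a, !s)))) =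
      pairProdErase A a (v ∘ σ) := by
    refine pairProdErase_congr fun c t hc => ?_
    simp only [comp_apply, Equiv.Perm.mul_apply]
    rw [Equiv.swap_apply_of_ne_of_ne (by simp) (by simp [hc])]
  rw [hfix]
  split_ifs with hσ
  swap
  · rfl
  simp only [G]
  rw [pairProd_eq a, pairProd_eq a, hR]
  cases s
  · simp only [comp_apply, hfix, hσ]
    simp only [Bool.not_false, Equiv.Perm.mul_apply, Equiv.swap_apply_left,
      Equiv.swap_apply_right]
    ring
  · simp only [comp_apply, hfix, hσ]
    simp only [Bool.not_true, Equiv.Perm.mul_apply, Equiv.swap_apply_left,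
      Equiv.swap_apply_right]
    rw [h.swap (v (σ none)), h.swap (v (σ (some (a, false))))]
    ring

theorem isKillingIn_contactForm (h : IsContactData ℓ A J ξ) :
    IsKillingIn (contactConnection ℓ A J ξ) (contactForm κ ℓ A) := by
  intro v j
  rw [derivationSum_contactConnection, h.sum_mul_contactForm_xi, h.sum_contactForm_J,
    sum_mul_contactForm_horizontal v (h.apply_J _)]
  ring

end IsContactData

theorem IsDarbouxFamily.contactForm_pos {κ' : Type*} {b : Option (κ' × Bool) → V}
    (hb : IsDarbouxFamily ℓ A ξ b) (h : IsContactData ℓ A J ξ) {f : κ → κ'}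
    (hf : Injective f) :
    0 < contactForm κ ℓ A (b ∘ Option.map (Prod.map f id)) := by
  rw [contactForm_apply]
  refine sum_pos' (fun σ _ => ?_) ⟨1, mem_univ _, ?_⟩
  swap
  · simp [contactProd, hb.none_eq, h.apply_xi, hb.pair]
  by_cases hnone : σ none = none
  swap
  · obtain ⟨q, hq⟩ := Option.ne_none_iff_exists'.1 hnone
    simp [contactProd, hq, hb.horizontal]
  obtain ⟨τ, rfl⟩ : ∃ τ : Equiv.Perm (κ × Bool), σ = Equiv.optionCongr τ := by
    refine ⟨Equiv.removeNone σ, ?_⟩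
    ext1 o
    simp [hnone]
  by_cases hpair : ∀ a, τ (a, true) = ((τ (a, false)).1, !(τ (a, false)).2)
  swap
  · push Not at hpair
    obtain ⟨a, ha⟩ := hpair
    rw [contactProd, prod_eq_zero (mem_univ a)]
    · simp
    · simp only [comp_apply, Equiv.optionCongr_apply, Option.map_some, Prod.map]
      refine hb.orth _ _ _ fun h0 => ha ?_
      simp only [id, Option.some.injEq, Prod.mk.injEq] at h0
      exact Prod.ext (hf h0.1) h0.2
  have hsurj : Surjective fun a => (τ (a, false)).1 := by
    intro c
    obtain ⟨⟨a, s⟩, ha⟩ := τ.surjective (c, false)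
    refine ⟨a, ?_⟩
    cases s
    · simp [ha]
    · rw [hpair] at ha
      exact congrArg Prod.fst ha
  let ρ : Equiv.Perm κ := Equiv.ofBijective _ (Finite.surjective_iff_bijective.1 hsurj)
  let ε : κ → Equiv.Perm Bool := fun a => if (τ (a, false)).2 then Equiv.swap false true else 1
  have hτ : τ = Equiv.prodCongrLeft (fun _ => ρ) * Equiv.prodCongrRight ε := by
    ext1 ⟨a, s⟩
    cases s <;> cases h2 : (τ (a, false)).2 <;>
      simp [ρ, ε, h2, hpair, Prod.ext_iff]
  have hsign : ((Equiv.Perm.sign τ : ℤ) : ℝ) =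
      ∏ a, if (τ (a, false)).2 then (-1 : ℝ) else 1 := by
    conv_lhs => rw [hτ]
    rw [Equiv.Perm.sign_mul, Equiv.Perm.sign_prodCongrLeft, Equiv.Perm.sign_prodCongrRight]
    simp only [prod_const, card_univ, Fintype.card_bool, Int.units_sq, one_mul,
      Units.coe_prod, Int.cast_prod]
    refine prod_congr rfl fun a _ => ?_
    simp only [ε]
    split_ifs <;> simp
  rw [Equiv.optionCongr_sign, hsign, contactProd]
  have hprod : ∀ a, A ((b ∘ Option.map (Prod.map f id)) (Equiv.optionCongr τ (some (a, false))))
      ((b ∘ Option.map (Prod.map f id)) (Equiv.optionCongr τ (some (a, true)))) =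
        if (τ (a, false)).2 then (-1 : ℝ) else 1 := by
    intro a
    rw [← hb.sign_mul_pair h (f (τ (a, false)).1) (τ (a, false)).2]
    simp [hpair, Prod.map]
  simp only [comp_apply] at hprod ⊢
  rw [prod_congr rfl fun a _ => hprod a]
  simp only [Equiv.optionCongr_apply, Option.map_none, hb.none_eq, h.apply_xi, one_mul]
  exact mul_self_nonneg _

end Existence

section CenterOne

open Function

theorem isKillingIn_smul_iff {V ι : Type*} [AddCommGroup V] [Module ℝ V] [Fintype ι]
    [DecidableEq ι] {T : V →ₗ[ℝ] V →ₗ[ℝ] V} {η : V [⋀^ι]→ₗ[ℝ] ℝ} {c : ℝ} (hc : c ≠ 0) :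
    IsKillingIn (c • T) η ↔ IsKillingIn T η := by
  have key : ∀ (v : ι → V) (x : V),
      derivationSum η ((c • T) x) v = c * derivationSum η (T x) v := fun v x => by
    simp [derivationSum, Finset.mul_sum]
  simp only [IsKillingIn, key, mul_eq_zero, hc, false_or]

namespace IsInnerProduct

variable {B : g →ₗ[ℝ] g →ₗ[ℝ] ℝ}

theorem eq_of_forall_apply_eq (hB : IsInnerProduct B) {x y : g} (h : ∀ z, B x z = B y z) :
    x = y := by
  by_contra hxy
  have := hB.posdef (x - y) (sub_ne_zero.2 hxy)
  rw [map_sub B, LinearMap.sub_apply, h, sub_self] at this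
  exact this.false

theorem exists_representing [FiniteDimensional ℝ g] (hB : IsInnerProduct B)
    (A : g →ₗ[ℝ] g →ₗ[ℝ] ℝ) : ∃ J : g →ₗ[ℝ] g, ∀ x y, B (J x) y = A x y := by
  have hinj : Injective B := fun x y h => hB.eq_of_forall_apply_eq fun z => by rw [h]
  let e : g ≃ₗ[ℝ] (g →ₗ[ℝ] ℝ) :=
    LinearEquiv.ofInjectiveOfFinrankEq B hinj (Subspace.dual_finrank_eq).symm
  refine ⟨e.symm.toLinearMap ∘ₗ A, fun x y => ?_⟩
  have : B (e.symm (A x)) = A x := e.apply_symm_apply (A x)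
  simp [this]

/-- A unit vector spanning a one-dimensional centre. -/
theorem exists_unit_center (hB : IsInnerProduct B)
    (hcenter : Module.finrank ℝ (LieAlgebra.center ℝ g) = 1) :
    ∃ ξ : g, B ξ ξ = 1 ∧ (∀ x : g, ⁅x, ξ⁆ = 0) ∧
      ∀ z : g, (∀ x : g, ⁅x, z⁆ = 0) → ∃ c : ℝ, z = c • ξ := by
  obtain ⟨⟨z, hz⟩, hz0, hspan⟩ := finrank_eq_one_iff'.1 hcenter
  have hz0' : z ≠ 0 := fun h => hz0 (Subtype.ext h)
  have hpos := hB.posdef z hz0'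
  have hs : 0 < √(B z z) := Real.sqrt_pos.2 hpos
  refine ⟨(√(B z z))⁻¹ • z, ?_, fun x => ?_, fun w hw => ?_⟩
  · simp only [map_smul, LinearMap.smul_apply, smul_eq_mul]
    field_simp
    exact (Real.sq_sqrt hpos.le).symm
  · rw [lie_smul, (LieModule.mem_maxTrivSubmodule ℝ g g z).1 hz x, smul_zero]
  · obtain ⟨c, hc⟩ := hspan ⟨w, (LieModule.mem_maxTrivSubmodule ℝ g g w).2 hw⟩
    refine ⟨c * √(B z z), ?_⟩
    rw [smul_smul, mul_assoc, mul_inv_cancel₀ hs.ne', mul_one]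
    exact (congrArg Subtype.val hc).symm

/-- The contact data of a 2-step nilpotent metric Lie algebra with one-dimensional centre. -/
theorem exists_contactData [FiniteDimensional ℝ g] (hB : IsInnerProduct B)
    (h2step : ∀ x y z : g, ⁅x, ⁅y, z⁆⁆ = 0)
    (hcenter : Module.finrank ℝ (LieAlgebra.center ℝ g) = 1)
    {D : g → g → g} (hD : IsLeviCivita B D) :
    ∃ (ℓ : g →ₗ[ℝ] ℝ) (A : g →ₗ[ℝ] g →ₗ[ℝ] ℝ) (J : g →ₗ[ℝ] g) (ξ : g),
      IsContactData ℓ A J ξ ∧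
        D = fun x y => ((1 / 2 : ℝ) • contactConnection ℓ A J ξ) x y := by
  obtain ⟨ξ, hξ, hξc, hspan⟩ := hB.exists_unit_center hcenter
  let A : g →ₗ[ℝ] g →ₗ[ℝ] ℝ := LinearMap.mk₂ ℝ (fun x y => B ξ ⁅x, y⁆)
    (by simp) (by simp) (by simp) (by simp)
  have hA : ∀ x y, A x y = B ξ ⁅x, y⁆ := fun _ _ => rfl
  obtain ⟨J, hJ⟩ := hB.exists_representing A
  have hbr : ∀ x y : g, ⁅x, y⁆ = A x y • ξ := by
    intro x y
    obtain ⟨c, hc⟩ := hspan ⁅x, y⁆ fun w => h2step w x y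
    rw [hA, hc, map_smul, hξ, smul_eq_mul, mul_one]
  have hswap : ∀ x y, A x y = -A y x := fun x y => by
    rw [hA, hA, ← lie_skew, map_neg]
  have hrad : ∀ x, (∀ y, A x y = 0) → ∃ c : ℝ, x = c • ξ := fun x hx =>
    hspan x fun w => by rw [hbr, hswap, hx, neg_zero, zero_smul]
  have hJℓ : ∀ x, B ξ (J x) = 0 := fun x => by rw [hB.symm, hJ, hA, hξc, map_zero]
  refine ⟨B ξ, A, J, ξ, ⟨hξ, fun x => by simp [hA], fun x => ?_, hJℓ, fun x y => ?_, hrad,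
    fun x hx => ?_⟩, ?_⟩
  · rw [hswap, hA, hξc, map_zero, neg_zero]
  · rw [hswap, ← hJ, ← hJ, hB.symm]
  · let K := LinearMap.ker (B ξ)
    let JK : K →ₗ[ℝ] K := J.restrict fun y _ => hJℓ y
    have hinj : Injective JK := by
      rw [← LinearMap.ker_eq_bot, LinearMap.ker_eq_bot']
      rintro ⟨y, hy⟩ hJy
      have hJy' : J y = 0 := congrArg Subtype.val hJy
      obtain ⟨c, rfl⟩ := hrad y fun w => by rw [← hJ, hJy', map_zero, LinearMap.zero_apply]
      have hc : c = 0 := by simpa [hξ] using LinearMap.mem_ker.1 hy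
      simp [hc]
    obtain ⟨⟨y, hy⟩, hyx⟩ := LinearMap.injective_iff_surjective.1 hinj ⟨x, hx⟩
    exact ⟨y, hy, congrArg Subtype.val hyx⟩
  · funext x y
    refine hB.eq_of_forall_apply_eq fun z => ?_
    have := hD x y z
    simp only [hbr, map_smul, LinearMap.smul_apply, smul_eq_mul] at this
    simp only [contactConnection_apply, map_smul, map_sub, LinearMap.smul_apply,
      LinearMap.sub_apply, smul_eq_mul, hJ]
    rw [hswap z x] at this
    linarith

end IsInnerProduct

/-- In odd degree the Killing forms are the multiples of a single nonzero form. -/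
theorem IsContactData.exists_generator {V : Type*} [AddCommGroup V] [Module ℝ V]
    [FiniteDimensional ℝ V] {ℓ : V →ₗ[ℝ] ℝ} {A : V →ₗ[ℝ] V →ₗ[ℝ] ℝ} {J : V →ₗ[ℝ] V} {ξ : V}
    (h : IsContactData ℓ A J ξ) {k : ℕ} (hodd : Odd k) (hk : k ≤ Module.finrank ℝ V) :
    ∃ η₀ : V [⋀^(Fin k)]→ₗ[ℝ] ℝ, η₀ ≠ 0 ∧ IsKillingIn (contactConnection ℓ A J ξ) η₀ ∧
      ∀ η : V [⋀^(Fin k)]→ₗ[ℝ] ℝ, IsKillingIn (contactConnection ℓ A J ξ) η ↔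
        ∃ c : ℝ, η = c • η₀ := by
  obtain ⟨p, rfl⟩ := hodd
  obtain ⟨m, b, hb⟩ := h.exists_darbouxFamily
  have hpm : p ≤ m := by
    have hfin := finrank_range_le_card (R := ℝ) b
    rw [Set.finrank, hb.span_eq_top, finrank_top] at hfin
    simp only [Fintype.card_option, Fintype.card_prod, Fintype.card_fin, Fintype.card_bool]
      at hfin
    omega
  let e : Option (Fin p × Bool) ≃ Fin (2 * p + 1) :=
    Fintype.equivFinOfCardEq (by simp [mul_comm])
  let f : Fin p ↪ Fin m := Fin.castLEEmb hpm
  let w : Option (Fin p × Bool) → Option (Fin m × Bool) := Option.map (Prod.map f id)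
  let η₀ : V [⋀^(Fin (2 * p + 1))]→ₗ[ℝ] ℝ := (contactForm (Fin p) ℓ A).domDomCongr e
  have hkill : IsKillingIn (contactConnection ℓ A J ξ) η₀ :=
    h.isKillingIn_contactForm.domDomCongr e
  have hpos : 0 < η₀ (b ∘ w ∘ e.symm) := by
    have := hb.contactForm_pos h f.injective
    simpa [η₀, w, Function.comp_def] using this
  refine ⟨η₀, fun h0 => by simp [h0] at hpos, hkill, fun η => ⟨fun hη => ?_, ?_⟩⟩
  · let c := η (b ∘ w ∘ e.symm) / η₀ (b ∘ w ∘ e.symm)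
    refine ⟨c, sub_eq_zero.1 ?_⟩
    refine hb.killing_eq_zero_of_vanishesOnPairs h (hη.sub (hkill.smul c))
      (I := Finset.univ.map f) (by simp) (VanishesOnPairs.of_injective (w ∘ e.symm) ?_ ?_)
    · rintro (_ | ⟨a, s⟩) ht
      · exact ⟨e none, by simp [w]⟩
      · obtain ⟨a', -, rfl⟩ := Finset.mem_map.1 (ht _ rfl)
        exact ⟨e (some (a', s)), by simp [w]⟩
    · simp [c, hpos.ne']
  · rintro ⟨c, rfl⟩
    exact hkill.smul c

end CenterOne

/-- On a 2-step nilpotent metric Lie algebra with 1-dimensional center, for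
`2 ≤ k ≤ dim 𝔫`: if `k` is even every Killing `k`-form is zero, and if `k` is odd the
space of Killing `k`-forms is a 1-dimensional subspace of the alternating `k`-forms. -/
theorem two_step_center_one_killing_forms {n : Type*} [LieRing n] [LieAlgebra ℝ n]
    [FiniteDimensional ℝ n]
    (B : n →ₗ[ℝ] n →ₗ[ℝ] ℝ) (hB : IsInnerProduct B)
    (hnonab : ∃ x y : n, ⁅x, y⁆ ≠ 0)
    (h2step : ∀ x y z : n, ⁅x, ⁅y, z⁆⁆ = 0)
    (hcenter : Module.finrank ℝ (LieAlgebra.center ℝ n) = 1)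
    (D : n → n → n) (hD : IsLeviCivita B D)
    (k : ℕ) [NeZero k] (hk2 : 2 ≤ k) (hkdim : k ≤ Module.finrank ℝ n) :
    (Even k → ∀ η : AlternatingMap ℝ n ℝ (Fin k), IsKillingForm D η → η = 0) ∧
    (Odd k → ∃ η₀ : AlternatingMap ℝ n ℝ (Fin k), η₀ ≠ 0 ∧ IsKillingForm D η₀ ∧
      ∀ η : AlternatingMap ℝ n ℝ (Fin k), IsKillingForm D η ↔ ∃ c : ℝ, η = c • η₀) := by
  obtain ⟨ℓ, A, J, ξ, h, hDT⟩ := hB.exists_contactData h2step hcenter hD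
  have hiff : ∀ η : AlternatingMap ℝ n ℝ (Fin k),
      IsKillingForm D η ↔ IsKillingIn (contactConnection ℓ A J ξ) η := fun η => by
    rw [hDT, isKillingForm_iff_isKillingIn, isKillingIn_smul_iff (by norm_num)]
  simp only [hiff]
  refine ⟨fun hk η hη => ?_, fun hk => h.exists_generator hk hkdim⟩
  obtain ⟨m, b, hb⟩ := h.exists_darbouxFamily
  exact hb.killing_eq_zero_of_even_card h hη (by simpa using hk)

end KillingForms
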